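/- Let A, U, M ∈ ℤ^{n×n}, let T ∈ ℤ^{n×n} be unit upper triangular, and let S = diag(s_1, …, s_n) be diagonal with positive diagonal entries. The rational matrix B := [[A, 0],[0, I_n]] · [[I_n, 0],[U, I_n]] · [[I_n, M],[0, T]] · [[I_n, 0],[0, S^{-1}]] has all integer entries if and only if A·M ≡ 0 (cmod S) and U·M + T ≡ 0 (cmod S), i.e., if and only if s_j divides every entry of column j of A·M and of column j of U·M + T. -/

import Mathlib

open Matrix

/-- The `2n × 2n` massaged matrix
`B = [[A,0],[0,I]] * [[I,0],[U,I]] * [[I,M],[0,T]] * [[I,0],[0,S⁻¹]]` over `ℚ`. -/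
noncomputable def massagedB (n : ℕ) (A U M T : Matrix (Fin n) (Fin n) ℤ)
    (s : Fin n → ℤ) : Matrix (Fin n ⊕ Fin n) (Fin n ⊕ Fin n) ℚ :=
  Matrix.fromBlocks (A.map ((↑) : ℤ → ℚ)) 0 0 1 *
  Matrix.fromBlocks 1 0 (U.map ((↑) : ℤ → ℚ)) 1 *
  Matrix.fromBlocks 1 (M.map ((↑) : ℤ → ℚ)) 0 (T.map ((↑) : ℤ → ℚ)) *
  Matrix.fromBlocks 1 0 0 (Matrix.diagonal (fun i => (s i : ℚ)))⁻¹

/-- A rational quotient of integers with nonzero denominator is integral iff the denominator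
divides the numerator. -/
theorem exists_intCast_eq_mul_inv_iff {a b : ℤ} (hb : b ≠ 0) :
    (∃ z : ℤ, (a : ℚ) * (b : ℚ)⁻¹ = z) ↔ b ∣ a := by
  have hb' : (b : ℚ) ≠ 0 := Int.cast_ne_zero.mpr hb
  refine exists_congr fun z => ?_
  rw [mul_inv_eq_iff_eq_mul₀ hb', mul_comm b z]
  norm_cast

theorem inv_diagonal_intCast {n : ℕ} {s : Fin n → ℤ} (hs : ∀ i, s i ≠ 0) :
    (Matrix.diagonal (fun i => (s i : ℚ)))⁻¹ = Matrix.diagonal (fun i => (s i : ℚ)⁻¹) := by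
  refine Matrix.inv_eq_right_inv ?_
  rw [Matrix.diagonal_mul_diagonal, ← Matrix.diagonal_one]
  congr 1
  funext i
  exact mul_inv_cancel₀ (Int.cast_ne_zero.mpr (hs i))

/-- The block form of the massaged matrix: `B = [[A, A·M·S⁻¹], [U, (U·M + T)·S⁻¹]]`. -/
theorem massagedB_eq_fromBlocks {n : ℕ} (A U M T : Matrix (Fin n) (Fin n) ℤ)
    {s : Fin n → ℤ} (hs : ∀ i, s i ≠ 0) :
    massagedB n A U M T s =
      Matrix.fromBlocks (A.map ((↑) : ℤ → ℚ))
        ((A * M).map ((↑) : ℤ → ℚ) * Matrix.diagonal (fun i => (s i : ℚ)⁻¹))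
        (U.map ((↑) : ℤ → ℚ))
        ((U * M + T).map ((↑) : ℤ → ℚ) * Matrix.diagonal (fun i => (s i : ℚ)⁻¹)) := by
  have hmul (X Y : Matrix (Fin n) (Fin n) ℤ) :
      (X * Y).map ((↑) : ℤ → ℚ) = X.map ((↑) : ℤ → ℚ) * Y.map ((↑) : ℤ → ℚ) :=
    Matrix.map_mul (f := Int.castRingHom ℚ)
  rw [Matrix.map_add _ Int.cast_add, hmul, hmul, massagedB, inv_diagonal_intCast hs]
  simp [Matrix.fromBlocks_multiply]

/-- The massaged matrix `B` has all integer entries iff `A·M ≡ 0 (cmod S)` and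
`U·M + T ≡ 0 (cmod S)`, i.e. `s j` divides every entry of column `j` of `A·M`
and of column `j` of `U·M + T`. -/
theorem massagedB_integral_iff (n : ℕ) (A U M T : Matrix (Fin n) (Fin n) ℤ)
    (hTut : ∀ i j : Fin n, j < i → T i j = 0)
    (hTdiag : ∀ i : Fin n, T i i = 1)
    (s : Fin n → ℤ) (hs : ∀ i, 0 < s i) :
    (∀ i j, ∃ z : ℤ, massagedB n A U M T s i j = (z : ℚ)) ↔
    ((∀ i j, s j ∣ (A * M) i j) ∧ (∀ i j, s j ∣ (U * M + T) i j)) := by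
  have hs' : ∀ i, s i ≠ 0 := fun i => (hs i).ne'
  simp only [massagedB_eq_fromBlocks A U M T hs', Sum.forall, Matrix.fromBlocks_apply₁₁,
    Matrix.fromBlocks_apply₁₂, Matrix.fromBlocks_apply₂₁, Matrix.fromBlocks_apply₂₂,
    Matrix.mul_diagonal, Matrix.map_apply, exists_intCast_eq_mul_inv_iff (hs' _),
    Int.cast_inj, exists_eq', implies_true, true_and]
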